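/- Fix j ∈ ℕ. There exists N = N(j) such that for all n ≥ N and all k ∈ {n−j, n−j+1, …, n}, under the Plancherel measure μ_n^(2) on partitions of n one has μ_n^(2)(λ_1 = k−1) · μ_n^(2)(λ_1 = k+1) ≤ (μ_n^(2)(λ_1 = k))². -/

import Mathlib

noncomputable section

/-- The number of standard Young tableaux of shape `μ`: semistandard tableaux whose
entries on the cells are exactly `0, 1, …, μ.card - 1`, each appearing once. -/
def sytCard (μ : YoungDiagram) : ℕ :=
  Nat.card {T : SemistandardYoungTableau μ //
    (∀ c ∈ μ.cells, T c.1 c.2 < μ.card) ∧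
    Set.InjOn (fun c : ℕ × ℕ => T c.1 c.2) ↑μ.cells}

/-- `μ_n^{(2)}(λ₁ = k)`: the probability, under the Plancherel measure
`μ_n^{(2)}(λ) = d_λ² / n!` on partitions of `n`, that the first row has length `k`. -/
def plancherelRowProb (n k : ℕ) : ℝ :=
  ∑' μ : {μ : YoungDiagram // μ.card = n ∧ μ.rowLen 0 = k},
    (sytCard μ.1 : ℝ) ^ 2 / (Nat.factorial n : ℝ)

open Finset

lemma yd_fst_lt {μ : YoungDiagram} {i j : ℕ} (h : (i, j) ∈ μ) : i < μ.card := by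
  have : ((range (i+1)).image (fun a => (a, j))) ⊆ μ.cells := by
    intro c hc
    simp only [mem_image, mem_range] at hc
    obtain ⟨a, ha, rfl⟩ := hc
    exact μ.up_left_mem (by omega) le_rfl h
  have h2 := card_le_card this
  rw [card_image_of_injective _ (fun a b hab => by simpa using hab), card_range] at h2
  exact h2

lemma yd_snd_lt {μ : YoungDiagram} {i j : ℕ} (h : (i, j) ∈ μ) : j < μ.card := by
  have : ((range (j+1)).image (fun a => (i, a))) ⊆ μ.cells := by
    intro c hc
    simp only [mem_image, mem_range] at hc
    obtain ⟨a, ha, rfl⟩ := hc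
    exact μ.up_left_mem le_rfl (by omega) h
  have h2 := card_le_card this
  rw [card_image_of_injective _ (fun a b hab => by simpa using hab), card_range] at h2
  exact h2

lemma yd_finite (n : ℕ) : {μ : YoungDiagram | μ.card = n}.Finite := by
  apply Set.Finite.of_finite_image (f := YoungDiagram.cells)
  · apply Set.Finite.subset (Finset.finite_toSet ((range n ×ˢ range n).powerset))
    rintro _ ⟨μ, hμ, rfl⟩
    simp only [coe_powerset, Set.mem_preimage, Set.mem_powerset_iff, coe_subset]
    rintro ⟨i, j⟩ hc
    simp only [Set.mem_ofPred_eq] at hμ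
    simp only [mem_product, mem_range]
    exact ⟨hμ ▸ yd_fst_lt hc, hμ ▸ yd_snd_lt hc⟩
  · intro a _ b _ h
    exact YoungDiagram.ext h

def yds (n : ℕ) : Finset YoungDiagram := (yd_finite n).toFinset

lemma mem_yds {n : ℕ} {μ : YoungDiagram} : μ ∈ yds n ↔ μ.card = n := by
  simp [yds]

open Classical in
def ydown (μ : YoungDiagram) : Finset YoungDiagram :=
  (yds (μ.card - 1)).filter (fun ν => ν ≤ μ ∧ ν.card + 1 = μ.card)

open Classical in
def yup (μ : YoungDiagram) : Finset YoungDiagram :=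
  (yds (μ.card + 1)).filter (fun ν => μ ≤ ν)

lemma mem_ydown {μ ν : YoungDiagram} : ν ∈ ydown μ ↔ ν ≤ μ ∧ ν.card + 1 = μ.card := by
  simp only [ydown, mem_filter, mem_yds]
  constructor
  · tauto
  · intro h
    exact ⟨by omega, h⟩

lemma mem_yup {μ ν : YoungDiagram} : ν ∈ yup μ ↔ μ ≤ ν ∧ ν.card = μ.card + 1 := by
  simp only [yup, mem_filter, mem_yds]
  tauto

lemma mem_ydown_iff_yup {μ ν : YoungDiagram} : ν ∈ ydown μ ↔ μ ∈ yup ν := by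
  rw [mem_ydown, mem_yup]
  constructor <;> rintro ⟨h, h'⟩ <;> exact ⟨h, by omega⟩

lemma yd_eq_of_le {μ ν : YoungDiagram} (h : μ ≤ ν) (hc : ν.card ≤ μ.card) : μ = ν :=
  YoungDiagram.ext (eq_of_subset_of_card_le h hc)

lemma yd_card_le {μ ν : YoungDiagram} (h : μ ≤ ν) : μ.card ≤ ν.card := card_le_card h

lemma yd_sup_inf (μ ν : YoungDiagram) :
    (μ ⊔ ν).card + (μ ⊓ ν).card = μ.card + ν.card := by
  exact card_union_add_card_inter μ.cells ν.cells

/-- rows where a cell may be added -/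
def addRows (μ : YoungDiagram) : Finset ℕ :=
  (range (μ.card + 1)).filter (fun i => i = 0 ∨ μ.rowLen i < μ.rowLen (i-1))

def remRows (μ : YoungDiagram) : Finset ℕ :=
  (range μ.card).filter (fun i => μ.rowLen (i+1) < μ.rowLen i)

lemma card_addRows (μ : YoungDiagram) : (addRows μ).card = (remRows μ).card + 1 := by
  have : addRows μ = insert 0 ((remRows μ).image Nat.succ) := by
    ext i
    simp only [addRows, remRows, mem_filter, mem_range, mem_insert, mem_image]
    cases i with
    | zero => simp
    | succ i => simp
  rw [this, card_insert_of_notMem (by simp), card_image_of_injective _ Nat.succ_injective]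

def addCell (μ : YoungDiagram) (i : ℕ) (h : i ∈ addRows μ) : YoungDiagram where
  cells := insert (i, μ.rowLen i) μ.cells
  isLowerSet := by
    rintro ⟨a, b⟩ ⟨c, d⟩ hle hm
    simp only [coe_insert, Set.mem_insert_iff, mem_coe, Prod.mk.injEq, YoungDiagram.mem_cells,
      YoungDiagram.mem_iff_lt_rowLen] at hm ⊢
    simp only [addRows, mem_filter, mem_range] at h
    obtain ⟨h1, h2⟩ := Prod.mk_le_mk.1 hle
    rcases hm with ⟨rfl, rfl⟩ | hm
    · rcases eq_or_lt_of_le h1 with rfl | h3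
      · omega
      · have := μ.rowLen_anti c (a-1) (by omega)
        omega
    · have := μ.rowLen_anti c a h1
      omega

def remCell (μ : YoungDiagram) (i : ℕ) (h : i ∈ remRows μ) : YoungDiagram where
  cells := μ.cells.erase (i, μ.rowLen i - 1)
  isLowerSet := by
    rintro ⟨a, b⟩ ⟨c, d⟩ hle hm
    simp only [coe_erase, Set.mem_sdiff, Set.mem_singleton_iff, mem_coe, Prod.mk.injEq,
      YoungDiagram.mem_cells, YoungDiagram.mem_iff_lt_rowLen] at hm ⊢
    simp only [remRows, mem_filter, mem_range] at h
    obtain ⟨h1, h2⟩ := Prod.mk_le_mk.1 hle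
    have := μ.rowLen_anti c a h1
    refine ⟨by omega, ?_⟩
    rintro ⟨rfl, rfl⟩
    rcases eq_or_lt_of_le h1 with rfl | h3
    · omega
    · have := μ.rowLen_anti (c+1) a h3
      omega

lemma card_yup (μ : YoungDiagram) : (yup μ).card = (addRows μ).card := by
  symm
  apply card_bij (fun i h => addCell μ i h)
  · intro i h
    rw [mem_yup]
    refine ⟨subset_insert _ _, ?_⟩
    apply card_insert_of_notMem
    simp [YoungDiagram.mem_iff_lt_rowLen]
  · intro i hi k hk h
    have h1 : (i, μ.rowLen i) ∈ addCell μ k hk := by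
      rw [← h]; exact mem_insert_self _ _
    have h2 := mem_insert.1 h1
    simp only [Prod.mk.injEq, YoungDiagram.mem_cells, YoungDiagram.mem_iff_lt_rowLen] at h2
    omega
  · intro ν hν
    rw [mem_yup] at hν
    obtain ⟨hle, hc⟩ := hν
    have hs : (ν.cells \ μ.cells).card = 1 := by
      rw [card_sdiff_of_subset hle]; unfold YoungDiagram.card at hc; omega
    obtain ⟨⟨i, j⟩, hij⟩ := card_eq_one.1 hs
    have hmem : ∀ a b, (b < ν.rowLen a ∧ ¬ b < μ.rowLen a) ↔ (a = i ∧ b = j) := by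
      intro a b
      have := Finset.ext_iff.1 hij (a, b)
      simpa [YoungDiagram.mem_iff_lt_rowLen] using this
    have h0 := (hmem i j).2 ⟨rfl, rfl⟩
    have h1 := hmem i (μ.rowLen i)
    have hj : j = μ.rowLen i := by
      have := h1.1 ⟨by omega, by omega⟩
      omega
    have hi : i ∈ addRows μ := by
      simp only [addRows, mem_filter, mem_range]
      refine ⟨?_, ?_⟩
      · have := yd_fst_lt (YoungDiagram.mem_iff_lt_rowLen.2 h0.1)
        omega
      · by_contra hcon
        push Not at hcon
        have h3 := hmem (i-1) j
        have h4 := ν.rowLen_anti (i-1) i (by omega)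
        have := h3.1 ⟨by omega, by omega⟩
        omega
    refine ⟨i, hi, ?_⟩
    apply yd_eq_of_le
    · intro c hcm
      rcases mem_insert.1 hcm with rfl | h
      · rw [YoungDiagram.mem_iff_lt_rowLen]; omega
      · exact hle h
    · rw [hc]
      apply le_of_eq
      symm
      apply card_insert_of_notMem
      simp [YoungDiagram.mem_iff_lt_rowLen]

lemma card_ydown (μ : YoungDiagram) : (ydown μ).card = (remRows μ).card := by
  symm
  have hin : ∀ i ∈ remRows μ, (i, μ.rowLen i - 1) ∈ μ.cells := by
    intro i hi
    simp only [remRows, mem_filter, mem_range] at hi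
    rw [YoungDiagram.mem_cells, YoungDiagram.mem_iff_lt_rowLen]; omega
  apply card_bij (fun i h => remCell μ i h)
  · intro i h
    rw [mem_ydown]
    exact ⟨erase_subset _ _, card_erase_add_one (hin i h)⟩
  · intro i hi k hk h
    by_contra hne
    have h1 : (i, μ.rowLen i - 1) ∈ remCell μ k hk :=
      mem_erase.2 ⟨by simp [hne], hin i hi⟩
    rw [← h] at h1
    exact (mem_erase.1 h1).1 rfl
  · intro ν hν
    rw [mem_ydown] at hν
    obtain ⟨hle, hc⟩ := hν
    have hs : (μ.cells \ ν.cells).card = 1 := by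
      rw [card_sdiff_of_subset hle]; unfold YoungDiagram.card at hc; omega
    obtain ⟨⟨i, j⟩, hij⟩ := card_eq_one.1 hs
    have hmem : ∀ a b, (b < μ.rowLen a ∧ ¬ b < ν.rowLen a) ↔ (a = i ∧ b = j) := by
      intro a b
      have := Finset.ext_iff.1 hij (a, b)
      simpa [YoungDiagram.mem_iff_lt_rowLen] using this
    have h0 := (hmem i j).2 ⟨rfl, rfl⟩
    have h1 := hmem i (μ.rowLen i - 1)
    have hj : j = μ.rowLen i - 1 := by
      have := h1.1 ⟨by omega, by omega⟩
      omega
    have hi : i ∈ remRows μ := by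
      simp only [remRows, mem_filter, mem_range]
      refine ⟨?_, ?_⟩
      · exact yd_fst_lt (YoungDiagram.mem_iff_lt_rowLen.2 h0.1)
      · by_contra hcon
        push Not at hcon
        have h3 := hmem (i+1) j
        have h4 := ν.rowLen_anti i (i+1) (by omega)
        have := h3.1 ⟨by omega, by omega⟩
        omega
    refine ⟨i, hi, ?_⟩
    symm
    apply yd_eq_of_le
    · intro c hcm
      refine mem_erase.2 ⟨?_, hle hcm⟩
      rintro rfl
      rw [YoungDiagram.mem_iff_lt_rowLen] at hcm
      omega
    · have := card_erase_add_one (hin i hi)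
      change (μ.cells.erase (i, μ.rowLen i - 1)).card ≤ _
      unfold YoungDiagram.card at *
      omega

lemma card_yup_ydown (μ : YoungDiagram) : (yup μ).card = (ydown μ).card + 1 := by
  rw [card_yup, card_ydown, card_addRows]

section dfun
variable (d : YoungDiagram → ℕ)

open Classical in
lemma swap_sum (μ : YoungDiagram) :
    ∑ l ∈ yup μ, ∑ ν ∈ (ydown l).erase μ, d ν = ∑ ρ ∈ ydown μ, ∑ ν ∈ (yup ρ).erase μ, d ν := by
  rw [sum_sigma', sum_sigma']
  have key1 : ∀ l ν, l ∈ yup μ → ν ∈ ydown l → ν ≠ μ →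
      (μ ⊔ ν = l ∧ μ ⊓ ν ∈ ydown μ ∧ ν ∈ yup (μ ⊓ ν)) := by
    intro l ν hl hν hne
    rw [mem_yup] at hl
    rw [mem_ydown] at hν
    have hcc : (μ ⊔ ν).card ≠ μ.card := by
      intro h
      have h1 := yd_eq_of_le (le_sup_left : μ ≤ μ ⊔ ν) h.le
      have h2 : ν ≤ μ := by rw [h1]; exact le_sup_right
      exact hne (yd_eq_of_le h2 (by omega))
    have h3 := yd_card_le (le_sup_left : μ ≤ μ ⊔ ν)
    have h4 : μ ⊔ ν ≤ l := sup_le hl.1 hν.1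
    have h5 := yd_card_le h4
    have h6 := yd_sup_inf μ ν
    rw [mem_ydown, mem_yup]
    refine ⟨yd_eq_of_le h4 (by omega), ⟨inf_le_left, by omega⟩, inf_le_right, by omega⟩
  have key2 : ∀ r ν, r ∈ ydown μ → ν ∈ yup r → ν ≠ μ →
      (μ ⊓ ν = r ∧ μ ⊔ ν ∈ yup μ ∧ ν ∈ ydown (μ ⊔ ν)) := by
    intro l ν hl hν hne
    rw [mem_ydown] at hl
    rw [mem_yup] at hν
    have hcc : (μ ⊓ ν).card ≠ μ.card := by
      intro h
      have h1 := yd_eq_of_le (inf_le_left : μ ⊓ ν ≤ μ) h.ge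
      have h2 : μ ≤ ν := by rw [← h1]; exact inf_le_right
      exact hne (yd_eq_of_le h2 (by omega)).symm
    have h3 := yd_card_le (inf_le_left : μ ⊓ ν ≤ μ)
    have h4 : l ≤ μ ⊓ ν := le_inf hl.1 hν.1
    have h5 := yd_card_le h4
    have h6 := yd_sup_inf μ ν
    rw [mem_ydown, mem_yup]
    refine ⟨(yd_eq_of_le h4 (by omega)).symm, ⟨le_sup_left, by omega⟩, le_sup_right, by omega⟩
  refine sum_bij' (fun x _ => ⟨μ ⊓ x.2, x.2⟩) (fun x _ => ⟨μ ⊔ x.2, x.2⟩) ?_ ?_ ?_ ?_ ?_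
  · rintro ⟨l, ν⟩ h
    simp only [mem_sigma, mem_erase] at h ⊢
    have := key1 l ν h.1 h.2.2 h.2.1
    exact ⟨this.2.1, h.2.1, this.2.2⟩
  · rintro ⟨l, ν⟩ h
    simp only [mem_sigma, mem_erase] at h ⊢
    have := key2 l ν h.1 h.2.2 h.2.1
    exact ⟨this.2.1, h.2.1, this.2.2⟩
  · rintro ⟨l, ν⟩ h
    simp only [mem_sigma, mem_erase] at h
    have := key1 l ν h.1 h.2.2 h.2.1
    simp [this.1]
  · rintro ⟨l, ν⟩ h
    simp only [mem_sigma, mem_erase] at h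
    have := key2 l ν h.1 h.2.2 h.2.1
    simp [this.1]
  · rintro ⟨l, ν⟩ h
    rfl

lemma sum_yup (hd : ∀ μ : YoungDiagram, μ.card ≠ 0 → d μ = ∑ ν ∈ ydown μ, d ν) (n : ℕ) :
    ∀ μ : YoungDiagram, μ.card = n → ∑ l ∈ yup μ, d l = (n + 1) * d μ := by
  classical
  induction n with
  | zero =>
    intro μ hμ
    have hdn : ydown μ = ∅ := by
      ext ν; simp only [mem_ydown, notMem_empty, iff_false]; omega
    have h1 : ∀ l ∈ yup μ, d l = d μ + ∑ ν ∈ (ydown l).erase μ, d ν := by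
      intro l hl
      rw [hd l (by have := mem_yup.1 hl; omega), add_sum_erase _ _ (mem_ydown_iff_yup.2 hl)]
    rw [sum_congr rfl h1, sum_add_distrib, swap_sum, hdn, sum_const, card_yup_ydown, hdn]
    simp
  | succ n ih =>
    intro μ hμ
    have h1 : ∀ l ∈ yup μ, d l = d μ + ∑ ν ∈ (ydown l).erase μ, d ν := by
      intro l hl
      rw [hd l (by have := mem_yup.1 hl; omega), add_sum_erase _ _ (mem_ydown_iff_yup.2 hl)]
    have h2 : ∀ r ∈ ydown μ, d μ + ∑ ν ∈ (yup r).erase μ, d ν = (n+1) * d r := by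
      intro r hr
      rw [add_sum_erase _ _ (mem_ydown_iff_yup.1 hr), ih r (by have := mem_ydown.1 hr; omega)]
    have h3 := sum_congr rfl h2
    rw [sum_add_distrib, sum_const, ← mul_sum, ← hd μ (by omega)] at h3
    rw [sum_congr rfl h1, sum_add_distrib, swap_sum, sum_const, card_yup_ydown]
    simp only [smul_eq_mul] at h3 ⊢
    linarith

lemma sum_sq (hd : ∀ μ : YoungDiagram, μ.card ≠ 0 → d μ = ∑ ν ∈ ydown μ, d ν)
    (h0 : d ⊥ = 1) (n : ℕ) : ∑ μ ∈ yds n, d μ ^ 2 = n.factorial := by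
  induction n with
  | zero =>
    have : yds 0 = {⊥} := by
      ext μ
      rw [mem_yds, mem_singleton, card_eq_zero]
      exact ⟨fun h => YoungDiagram.ext h, fun h => by rw [h]; rfl⟩
    simp [this, h0]
  | succ n ih =>
    have h1 : ∀ l ∈ yds (n+1), d l ^ 2 = ∑ ν ∈ ydown l, d l * d ν := by
      intro l hl
      rw [← mul_sum, ← hd l (by have := mem_yds.1 hl; omega), sq]
    rw [sum_congr rfl h1, sum_comm' (t' := yds n) (s' := fun ν => yup ν)]
    · have h2 : ∀ ν ∈ yds n, ∑ l ∈ yup ν, d l * d ν = (n+1) * d ν ^ 2 := by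
        intro ν hν
        rw [← sum_mul, sum_yup d hd n ν (mem_yds.1 hν)]; ring
      rw [sum_congr rfl h2, ← mul_sum, ih, Nat.factorial_succ]
    · intro l ν
      rw [mem_yds, mem_yds, mem_ydown, mem_yup]
      constructor
      · rintro ⟨h1, h2, h3⟩
        exact ⟨⟨h2, by omega⟩, by omega⟩
      · rintro ⟨⟨h2, h3⟩, h1⟩
        exact ⟨by omega, h2, by omega⟩

end dfun

abbrev SYT (μ : YoungDiagram) := {T : SemistandardYoungTableau μ //
    (∀ c ∈ μ.cells, T c.1 c.2 < μ.card) ∧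
    Set.InjOn (fun c : ℕ × ℕ => T c.1 c.2) ↑μ.cells}

instance syt_finite (μ : YoungDiagram) : Finite (SYT μ) := by
  let F : SYT μ → (μ.cells → Fin μ.card) := fun T c => ⟨T.1 c.1.1 c.1.2, T.2.1 c.1 c.2⟩
  apply Finite.of_injective F
  intro T T' h
  apply Subtype.ext
  apply SemistandardYoungTableau.ext
  intro i j
  by_cases hij : (i, j) ∈ μ
  · have := congrFun h ⟨(i, j), hij⟩
    simpa [F] using this
  · rw [T.1.zeros hij, T'.1.zeros hij]

lemma sytCard_bot : sytCard ⊥ = 1 := by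
  unfold sytCard
  rw [Nat.card_eq_one_iff_unique]
  refine ⟨⟨?_⟩, ⟨⟨default, ?_, ?_⟩⟩⟩
  · intro T T'
    apply Subtype.ext
    apply SemistandardYoungTableau.ext
    intro i j
    rw [T.1.zeros (by simp), T'.1.zeros (by simp)]
  · simp
  · simp

/-- extend a tableau by putting the largest entry in the extra cell -/
def sytExt {μ ν : YoungDiagram} (hle : ν ≤ μ) (hc : ν.card + 1 = μ.card) (T : SYT ν) : SYT μ := by
  have huniq : ∀ c c' : ℕ × ℕ, c ∈ μ → c' ∈ μ → c ∉ ν → c' ∉ ν → c = c' := by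
    have hs : (μ.cells \ ν.cells).card = 1 := by
      rw [card_sdiff_of_subset hle]; unfold YoungDiagram.card at hc; omega
    intro c c' h1 h2 h3 h4
    exact card_le_one.1 hs.le c (mem_sdiff.2 ⟨h1, h3⟩) c' (mem_sdiff.2 ⟨h2, h4⟩)
  refine ⟨⟨fun i j => if (i, j) ∈ ν then T.1 i j else if (i, j) ∈ μ then ν.card else 0,
    ?_, ?_, ?_⟩, ?_, ?_⟩
  · intro i j1 j2 hj hm
    have hm1 := μ.up_left_mem le_rfl hj.le hm
    by_cases h2 : (i, j2) ∈ ν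
    · have h1 := ν.up_left_mem le_rfl hj.le h2
      simp only [h1, h2, if_true]
      exact T.1.row_weak hj h2
    · by_cases h1 : (i, j1) ∈ ν
      · simp only [h1, h2, hm, if_true, if_false]
        exact (T.2.1 _ h1).le
      · simp [h1, h2, hm, hm1]
  · intro i1 i2 j hi hm
    have hm1 := μ.up_left_mem hi.le le_rfl hm
    by_cases h2 : (i2, j) ∈ ν
    · have h1 := ν.up_left_mem hi.le le_rfl h2
      simp only [h1, h2, if_true]
      exact T.1.col_strict hi h2
    · by_cases h1 : (i1, j) ∈ ν
      · simp only [h1, h2, hm, if_true, if_false]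
        exact (T.2.1 _ h1)
      · have := huniq _ _ hm hm1 h2 h1
        simp only [Prod.mk.injEq] at this
        omega
  · intro i j h
    have h1 : (i, j) ∉ ν := fun h' => h (hle h')
    simp [h, h1]
  · rintro ⟨i, j⟩ hm
    change (if (i, j) ∈ ν then T.1 i j else if (i, j) ∈ μ then ν.card else 0) < _
    by_cases h1 : (i, j) ∈ ν
    · have := T.2.1 _ h1
      simp only [h1, if_true]
      simp only at this
      omega
    · have hm' : (i, j) ∈ μ := hm
      simp only [h1, hm', if_true, if_false]
      omega
  · rintro ⟨i, j⟩ hm ⟨i', j'⟩ hm' heq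
    change (if (i, j) ∈ ν then T.1 i j else if (i, j) ∈ μ then ν.card else 0) =
      (if (i', j') ∈ ν then T.1 i' j' else if (i', j') ∈ μ then ν.card else 0) at heq
    have h1 : (i, j) ∈ μ := hm
    have h1' : (i', j') ∈ μ := hm'
    by_cases h2 : (i, j) ∈ ν
    · have h3 := T.2.1 _ h2
      by_cases h2' : (i', j') ∈ ν
      · simp only [h2, h2', if_true] at heq
        exact T.2.2 h2 h2' heq
      · simp only [h2, h2', h1', if_true, if_false] at heq
        simp only at h3
        omega
    · by_cases h2' : (i', j') ∈ ν
      · have h3 := T.2.1 _ h2'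
        simp only [h2, h2', h1, if_true, if_false] at heq
        simp only at h3
        omega
      · exact huniq _ _ h1 h1' h2 h2'

lemma sytExt_apply {μ ν : YoungDiagram} (hle : ν ≤ μ) (hc : ν.card + 1 = μ.card) (T : SYT ν)
    (i j : ℕ) : (sytExt hle hc T).1 i j =
      if (i, j) ∈ ν then T.1 i j else if (i, j) ∈ μ then ν.card else 0 := rfl

lemma sytExt_lt_iff {μ ν : YoungDiagram} (hle : ν ≤ μ) (hc : ν.card + 1 = μ.card) (T : SYT ν)
    (c : ℕ × ℕ) (hm : c ∈ μ) : (sytExt hle hc T).1 c.1 c.2 < ν.card ↔ c ∈ ν := by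
  obtain ⟨i, j⟩ := c
  rw [sytExt_apply]
  by_cases h1 : (i, j) ∈ ν
  · simpa [h1] using T.2.1 _ h1
  · simp [h1, hm]

/-- remove the largest entry: diagram -/
def sytRes {μ : YoungDiagram} (T : SYT μ) (n : ℕ) : YoungDiagram where
  cells := μ.cells.filter (fun c => T.1 c.1 c.2 < n)
  isLowerSet := by
    rintro ⟨a, b⟩ ⟨c, d⟩ hle hm
    simp only [coe_filter, Set.mem_ofPred_eq, YoungDiagram.mem_cells] at hm ⊢
    obtain ⟨h1, h2⟩ := Prod.mk_le_mk.1 hle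
    refine ⟨μ.up_left_mem h1 h2 hm.1, ?_⟩
    have h3 := T.1.col_weak h1 hm.1
    have h4 := T.1.row_weak_of_le h2 (μ.up_left_mem h1 le_rfl hm.1)
    omega

lemma mem_sytRes {μ : YoungDiagram} (T : SYT μ) (n : ℕ) (c : ℕ × ℕ) :
    c ∈ sytRes T n ↔ c ∈ μ ∧ T.1 c.1 c.2 < n := by
  change c ∈ μ.cells.filter (fun c => T.1 c.1 c.2 < n) ↔ _
  simp

lemma card_sytRes {μ : YoungDiagram} (T : SYT μ) (n : ℕ) (h : n + 1 = μ.card) :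
    (sytRes T n).card = n := by
  have himg : μ.cells.image (fun c => T.1 c.1 c.2) = range (n+1) := by
    apply eq_of_subset_of_card_le
    · intro x hx
      obtain ⟨c, hc, rfl⟩ := mem_image.1 hx
      rw [mem_range, h]
      exact T.2.1 c hc
    · rw [card_image_of_injOn T.2.2, card_range, h]
  have : (sytRes T n).cells.image (fun c => T.1 c.1 c.2) = range n := by
    ext x
    constructor
    · intro hx
      obtain ⟨c, hc, rfl⟩ := mem_image.1 hx
      exact mem_range.2 ((mem_sytRes T n c).1 hc).2
    · intro hx
      have hx' := mem_range.1 hx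
      have : x ∈ μ.cells.image (fun c => T.1 c.1 c.2) := by
        rw [himg, mem_range]; omega
      obtain ⟨c, hc, rfl⟩ := mem_image.1 this
      exact mem_image.2 ⟨c, (mem_sytRes T n c).2 ⟨hc, hx'⟩, rfl⟩
  have h2 : ((sytRes T n).cells.image (fun c => T.1 c.1 c.2)).card = (sytRes T n).card := by
    apply card_image_of_injOn
    apply T.2.2.mono
    exact filter_subset _ _
  rw [← h2, this, card_range]

lemma sytRes_le {μ : YoungDiagram} (T : SYT μ) (n : ℕ) : sytRes T n ≤ μ := filter_subset _ _

def sytRestrict {μ : YoungDiagram} (T : SYT μ) (n : ℕ) (h : n + 1 = μ.card) :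
    SYT (sytRes T n) := by
  refine ⟨⟨fun i j => if (i, j) ∈ sytRes T n then T.1 i j else 0, ?_, ?_, ?_⟩, ?_, ?_⟩
  · intro i j1 j2 hj hm
    have hm1 := (sytRes T n).up_left_mem le_rfl hj.le hm
    simp only [hm, hm1, if_true]
    exact T.1.row_weak hj (sytRes_le T n hm)
  · intro i1 i2 j hi hm
    have hm1 := (sytRes T n).up_left_mem hi.le le_rfl hm
    simp only [hm, hm1, if_true]
    exact T.1.col_strict hi (sytRes_le T n hm)
  · intro i j hm
    simp [hm]
  · rintro ⟨i, j⟩ hm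
    change (if (i, j) ∈ sytRes T n then T.1 i j else 0) < _
    rw [card_sytRes T n h]
    have hm' : (i, j) ∈ sytRes T n := hm
    simp only [hm', if_true]
    exact ((mem_sytRes T n _).1 hm').2
  · rintro ⟨i, j⟩ hm ⟨i', j'⟩ hm' heq
    change (if (i, j) ∈ sytRes T n then T.1 i j else 0) =
      (if (i', j') ∈ sytRes T n then T.1 i' j' else 0) at heq
    have h1 : (i, j) ∈ sytRes T n := hm
    have h1' : (i', j') ∈ sytRes T n := hm'
    simp only [h1, h1', if_true] at heq
    exact T.2.2 (sytRes_le T n h1) (sytRes_le T n h1') heq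

lemma sytCard_rec (μ : YoungDiagram) (h : μ.card ≠ 0) :
    sytCard μ = ∑ ν ∈ ydown μ, sytCard ν := by
  let G : (Σ ν : ydown μ, SYT ν.1) → SYT μ := fun x =>
    sytExt (mem_ydown.1 x.1.2).1 (mem_ydown.1 x.1.2).2 x.2
  have hG : Function.Bijective G := by
    constructor
    · rintro ⟨⟨ν, hν⟩, T⟩ ⟨⟨ν', hν'⟩, T'⟩ heq
      simp only [G] at heq
      have h1 := mem_ydown.1 hν
      have h2 := mem_ydown.1 hν'
      have h3 : ν = ν' := by
        apply YoungDiagram.ext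
        ext c
        constructor
        · intro hc
          have := (sytExt_lt_iff h1.1 h1.2 T c (h1.1 hc)).2 hc
          rw [heq] at this
          exact (sytExt_lt_iff h2.1 h2.2 T' c (h1.1 hc)).1 (by omega)
        · intro hc
          have := (sytExt_lt_iff h2.1 h2.2 T' c (h2.1 hc)).2 hc
          rw [← heq] at this
          exact (sytExt_lt_iff h1.1 h1.2 T c (h2.1 hc)).1 (by omega)
      subst h3
      have h4 : T = T' := by
        apply Subtype.ext
        apply SemistandardYoungTableau.ext
        intro i j
        by_cases hm : (i, j) ∈ ν
        · have a1 := sytExt_apply h1.1 h1.2 T i j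
          have a2 := sytExt_apply h1.1 h1.2 T' i j
          rw [if_pos hm] at a1 a2
          rw [← a1, ← a2, heq]
        · rw [T.1.zeros hm, T'.1.zeros hm]
      rw [h4]
    · intro T
      have hn : (μ.card - 1) + 1 = μ.card := by omega
      have hc := card_sytRes T _ hn
      have hmem : sytRes T (μ.card - 1) ∈ ydown μ :=
        mem_ydown.2 ⟨sytRes_le _ _, by omega⟩
      refine ⟨⟨⟨_, hmem⟩, sytRestrict T _ hn⟩, ?_⟩
      apply Subtype.ext
      apply SemistandardYoungTableau.ext
      intro i j
      simp only [G]
      rw [sytExt_apply]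
      by_cases hm : (i, j) ∈ sytRes T (μ.card - 1)
      · rw [if_pos hm]
        change (if (i, j) ∈ sytRes T (μ.card - 1) then T.1 i j else 0) = _
        rw [if_pos hm]
      · rw [if_neg hm]
        by_cases hm' : (i, j) ∈ μ
        · rw [if_pos hm', hc]
          rw [mem_sytRes] at hm
          have := T.2.1 _ hm'
          simp only [hm', true_and] at hm
          simp only at this
          omega
        · rw [if_neg hm', T.1.zeros hm']
  have h1 : sytCard μ = Nat.card (SYT μ) := rfl
  rw [h1, ← Nat.card_congr (Equiv.ofBijective G hG), Nat.card_sigma,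
    ← sum_coe_sort (ydown μ)]
  rfl

lemma rowLen_zero_le_card (μ : YoungDiagram) : μ.rowLen 0 ≤ μ.card := by
  rw [YoungDiagram.rowLen_eq_card]
  exact card_le_card (filter_subset _ _)

lemma shift_inj : Function.Injective (fun c : ℕ × ℕ => (c.1 + 1, c.2)) := by
  rintro ⟨a, b⟩ ⟨c, d⟩ h
  simpa using h

def ytail (μ : YoungDiagram) : YoungDiagram where
  cells := μ.cells.preimage (fun c => (c.1 + 1, c.2)) (shift_inj.injOn)
  isLowerSet := by
    rintro ⟨a, b⟩ ⟨c, d⟩ hle hm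
    rw [mem_coe, mem_preimage] at hm ⊢
    obtain ⟨h1, h2⟩ := Prod.mk_le_mk.1 hle
    exact μ.up_left_mem (by omega) h2 hm

lemma mem_ytail {μ : YoungDiagram} {i j : ℕ} : (i, j) ∈ ytail μ ↔ (i + 1, j) ∈ μ := by
  rw [← YoungDiagram.mem_cells, ytail, mem_preimage]; rfl

def ycons (k : ℕ) (ν : YoungDiagram) : YoungDiagram where
  cells := (range k).image (fun j => (0, j)) ∪
    (ν.cells.filter (fun c => c.2 < k)).image (fun c => (c.1 + 1, c.2))
  isLowerSet := by
    rintro ⟨a, b⟩ ⟨c, d⟩ hle hm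
    obtain ⟨h1, h2⟩ := Prod.mk_le_mk.1 hle
    simp only [coe_union, coe_image, Set.mem_union, Set.mem_image, mem_coe, mem_range, mem_filter,
      Prod.mk.injEq, Prod.exists, YoungDiagram.mem_cells] at hm ⊢
    rcases hm with ⟨x, hx, rfl, rfl⟩ | ⟨x, y, ⟨hx, hy⟩, rfl, rfl⟩
    · exact Or.inl ⟨d, by omega, by omega, rfl⟩
    · rcases Nat.eq_zero_or_pos c with rfl | hc
      · exact Or.inl ⟨d, by omega, by omega, rfl⟩
      · exact Or.inr ⟨c-1, d, ⟨ν.up_left_mem (by omega) h2 hx, by omega⟩, by omega, rfl⟩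

lemma mem_ycons_zero {k j : ℕ} {ν : YoungDiagram} : (0, j) ∈ ycons k ν ↔ j < k := by
  rw [← YoungDiagram.mem_cells, ycons]
  simp

lemma mem_ycons_succ {k i j : ℕ} {ν : YoungDiagram} :
    (i + 1, j) ∈ ycons k ν ↔ (i, j) ∈ ν ∧ j < k := by
  rw [← YoungDiagram.mem_cells, ycons]
  simp

lemma yd_ext' {μ ν : YoungDiagram} (h : ∀ i j, (i, j) ∈ μ ↔ (i, j) ∈ ν) : μ = ν := by
  apply YoungDiagram.ext
  ext ⟨i, j⟩
  exact h i j

lemma rowLen_ycons (k : ℕ) (ν : YoungDiagram) : (ycons k ν).rowLen 0 = k := by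
  apply eq_of_forall_lt_iff
  intro j
  rw [← YoungDiagram.mem_iff_lt_rowLen, mem_ycons_zero]

lemma lt_rowLen_zero {μ : YoungDiagram} {i j : ℕ} (h : (i, j) ∈ μ) : j < μ.rowLen 0 :=
  YoungDiagram.mem_iff_lt_rowLen.1 (μ.up_left_mem (Nat.zero_le _) le_rfl h)

lemma ycons_ytail (μ : YoungDiagram) : ycons (μ.rowLen 0) (ytail μ) = μ := by
  apply yd_ext'
  intro i j
  cases i with
  | zero => rw [mem_ycons_zero, YoungDiagram.mem_iff_lt_rowLen]
  | succ i =>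
    rw [mem_ycons_succ, mem_ytail]
    exact ⟨fun h => h.1, fun h => ⟨h, lt_rowLen_zero h⟩⟩

lemma ytail_ycons {k : ℕ} {ν : YoungDiagram} (h : ν.rowLen 0 ≤ k) : ytail (ycons k ν) = ν := by
  apply yd_ext'
  intro i j
  rw [mem_ytail, mem_ycons_succ]
  exact ⟨fun h => h.1, fun h' => ⟨h', (lt_rowLen_zero h').trans_le h⟩⟩

lemma card_ytail (μ : YoungDiagram) : μ.card = μ.rowLen 0 + (ytail μ).card := by
  have h1 : μ.cells.filter (fun c => ¬ c.1 = 0) =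
      (ytail μ).cells.image (fun c => (c.1 + 1, c.2)) := by
    ext ⟨i, j⟩
    simp only [mem_filter, mem_image, YoungDiagram.mem_cells, Prod.exists, Prod.mk.injEq]
    constructor
    · rintro ⟨h, h'⟩
      refine ⟨i-1, j, mem_ytail.2 ?_, by omega, rfl⟩
      rwa [Nat.sub_add_cancel (by omega)]
    · rintro ⟨a, b, h, rfl, rfl⟩
      exact ⟨mem_ytail.1 h, by omega⟩
  have h2 : (μ.cells.filter (fun c => ¬ c.1 = 0)).card = (ytail μ).card := by
    rw [h1, card_image_of_injective]
    rintro ⟨a, b⟩ ⟨c, d⟩ h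
    simpa using h
  rw [← h2, YoungDiagram.rowLen_eq_card, YoungDiagram.row]
  exact (card_filter_add_card_filter_not _).symm

lemma card_ycons {k : ℕ} {ν : YoungDiagram} (h : ν.rowLen 0 ≤ k) :
    (ycons k ν).card = k + ν.card := by
  rw [card_ytail, rowLen_ycons, ytail_ycons h]

lemma rowLen_mono {μ ν : YoungDiagram} (h : μ ≤ ν) (i : ℕ) : μ.rowLen i ≤ ν.rowLen i := by
  by_contra hc
  push Not at hc
  have := h (YoungDiagram.mem_iff_lt_rowLen.2 hc)
  rw [YoungDiagram.mem_iff_lt_rowLen] at this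
  omega

lemma ytail_mono {μ ν : YoungDiagram} (h : μ ≤ ν) : ytail μ ≤ ytail ν := by
  rintro ⟨i, j⟩ hm
  exact mem_ytail.2 (h (mem_ytail.1 hm))

lemma ycons_mono {k l : ℕ} {μ ν : YoungDiagram} (hk : k ≤ l) (h : μ ≤ ν) :
    ycons k μ ≤ ycons l ν := by
  rintro ⟨i, j⟩ hm
  cases i with
  | zero => rw [mem_ycons_zero] at *; omega
  | succ i =>
    have hm' := mem_ycons_succ.1 hm
    exact mem_ycons_succ.2 ⟨h hm'.1, by omega⟩

lemma mem_ydown_ycons {k : ℕ} {ν μ : YoungDiagram} (h : ν.rowLen 0 ≤ k) :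
    μ ∈ ydown (ycons k ν) ↔ (∃ ρ ∈ ydown ν, μ = ycons k ρ) ∨
      (ν.rowLen 0 < k ∧ μ = ycons (k-1) ν) := by
  rw [mem_ydown, card_ycons h]
  constructor
  · rintro ⟨hle, hc⟩
    have h1 := rowLen_mono hle 0
    have h2 := ytail_mono hle
    rw [rowLen_ycons] at h1
    rw [ytail_ycons h] at h2
    rw [card_ytail] at hc
    have h3 := yd_card_le h2
    by_cases h4 : μ.rowLen 0 = k
    · left
      refine ⟨ytail μ, mem_ydown.2 ⟨h2, by omega⟩, ?_⟩
      rw [← h4, ycons_ytail]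
    · right
      have h5 : ytail μ = ν := yd_eq_of_le h2 (by omega)
      have h6 : μ.rowLen 0 = k - 1 := by omega
      refine ⟨?_, by rw [← h5, ← h6, ycons_ytail]⟩
      rw [← h5]
      by_contra hcon
      push Not at hcon
      have h7 : k - 1 < (ytail μ).rowLen 0 := by omega
      have := lt_rowLen_zero (mem_ytail.1 (YoungDiagram.mem_iff_lt_rowLen.2 h7))
      omega
  · rintro (⟨ρ, hρ, rfl⟩ | ⟨hlt, rfl⟩)
    · rw [mem_ydown] at hρ
      have := rowLen_mono hρ.1 0
      exact ⟨ycons_mono le_rfl hρ.1, by rw [card_ycons (by omega)]; omega⟩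
    · exact ⟨ycons_mono (by omega) le_rfl, by rw [card_ycons (by omega)]; omega⟩

lemma sum_ydown_ycons {k : ℕ} {ν : YoungDiagram} (h : ν.rowLen 0 ≤ k) (hk : k ≠ 0) :
    sytCard (ycons k ν) = (if ν.rowLen 0 < k then sytCard (ycons (k-1) ν) else 0) +
      ∑ ρ ∈ ydown ν, sytCard (ycons k ρ) := by
  classical
  have hinj : Set.InjOn (ycons k) (ydown ν : Set YoungDiagram) := by
    intro a ha b hb hab
    have h1 := rowLen_mono (mem_ydown.1 (mem_coe.1 ha)).1 0
    have h2 := rowLen_mono (mem_ydown.1 (mem_coe.1 hb)).1 0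
    rw [← ytail_ycons (h1.trans h), ← ytail_ycons (h2.trans h), hab]
  rw [sytCard_rec _ (by rw [card_ycons h]; omega), ← sum_image hinj]
  split_ifs with hlt
  · have : ydown (ycons k ν) = insert (ycons (k-1) ν) ((ydown ν).image (ycons k)) := by
      ext μ
      rw [mem_ydown_ycons h, mem_insert, mem_image]
      constructor
      · rintro (⟨ρ, h1, rfl⟩ | h)
        · exact Or.inr ⟨ρ, h1, rfl⟩
        · exact Or.inl h.2
      · rintro (h | ⟨ρ, h1, rfl⟩)
        · exact Or.inr ⟨hlt, h⟩
        · exact Or.inl ⟨ρ, h1, rfl⟩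
    rw [this, sum_insert]
    intro hm
    obtain ⟨ρ, _, h2⟩ := mem_image.1 hm
    have := congrArg (fun x => YoungDiagram.rowLen x 0) h2
    simp only [rowLen_ycons] at this
    omega
  · have : ydown (ycons k ν) = ((ydown ν).image (ycons k)) := by
      ext μ
      rw [mem_ydown_ycons h, mem_image]
      constructor
      · rintro (⟨ρ, h1, rfl⟩ | h)
        · exact ⟨ρ, h1, rfl⟩
        · exact absurd h.1 hlt
      · rintro ⟨ρ, h1, rfl⟩
        exact Or.inl ⟨ρ, h1, rfl⟩
    rw [this, zero_add]

lemma sytCard_zero {μ : YoungDiagram} (h : μ.card = 0) : sytCard μ = 1 := by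
  have : μ = ⊥ := YoungDiagram.ext (card_eq_zero.1 h)
  rw [this, sytCard_bot]

lemma card_zero_of_rowLen {μ : YoungDiagram} (h : μ.rowLen 0 = 0) : μ.card = 0 := by
  rw [card_eq_zero, eq_empty_iff_forall_notMem]
  rintro ⟨i, j⟩ hm
  have := lt_rowLen_zero hm
  omega

lemma ydown_zero {μ : YoungDiagram} (h : μ.card = 0) : ydown μ = ∅ := by
  ext ν; simp only [mem_ydown, notMem_empty, iff_false]; omega

lemma sytCard_ycons_zero {ν : YoungDiagram} (h : ν.card = 0) (k : ℕ) :
    sytCard (ycons k ν) = 1 := by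
  have h0 : ν.rowLen 0 = 0 := by have := rowLen_zero_le_card ν; omega
  induction k with
  | zero => exact sytCard_zero (by rw [card_ycons (by omega)]; omega)
  | succ k ih =>
    rw [sum_ydown_ycons (by omega) (by omega), if_pos (by omega), ydown_zero h]
    simpa using ih

lemma syt_upper (s : ℕ) : ∀ (k : ℕ) (ν : YoungDiagram), k + ν.card = s → ν.rowLen 0 ≤ k →
    sytCard (ycons k ν) ≤ (k + ν.card).choose ν.card * sytCard ν := by
  induction s with
  | zero =>
    intro k ν hs h
    have h0 : ν.card = 0 := by omega
    rw [sytCard_ycons_zero h0, sytCard_zero h0, h0]; simp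
  | succ s ih =>
    intro k ν hs h
    rcases Nat.eq_zero_or_pos ν.card with h0 | hpos
    · rw [sytCard_ycons_zero h0, sytCard_zero h0, h0]; simp
    · obtain ⟨m, hm⟩ : ∃ m, ν.card = m + 1 := ⟨ν.card - 1, by omega⟩
      have hk : k ≠ 0 := by
        rintro rfl
        have := card_zero_of_rowLen (Nat.le_zero.1 h)
        omega
      obtain ⟨l, rfl⟩ : ∃ l, k = l + 1 := ⟨k - 1, by omega⟩
      rw [sum_ydown_ycons h hk]
      have h1 : (if ν.rowLen 0 < l + 1 then sytCard (ycons (l + 1 - 1) ν) else 0) ≤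
          (l + m + 1).choose (m + 1) * sytCard ν := by
        split_ifs with hlt
        · have := ih l ν (by omega) (by omega)
          rw [hm] at this
          exact this
        · exact Nat.zero_le _
      have h2 : ∑ ρ ∈ ydown ν, sytCard (ycons (l + 1) ρ) ≤ (l + m + 1).choose m * sytCard ν := by
        rw [sytCard_rec ν (by omega), mul_sum]
        apply sum_le_sum
        intro ρ hρ
        rw [mem_ydown] at hρ
        have hr := rowLen_mono hρ.1 0
        have := ih (l+1) ρ (by omega) (by omega)
        have hc : ρ.card = m := by omega
        rw [hc, show l + 1 + m = l + m + 1 by ring] at this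
        exact this
      rw [hm, show l + 1 + (m + 1) = (l + m + 1) + 1 by ring, Nat.choose_succ_succ, add_mul]
      simp only [Nat.succ_eq_add_one] at *
      omega

lemma syt_lower (s : ℕ) : ∀ (k : ℕ) (ν : YoungDiagram), k + ν.card = s → ν.rowLen 0 ≤ k →
    k.choose ν.card * sytCard ν ≤ sytCard (ycons k ν) := by
  induction s with
  | zero =>
    intro k ν hs h
    have h0 : ν.card = 0 := by omega
    rw [sytCard_ycons_zero h0, sytCard_zero h0, h0]; simp
  | succ s ih =>
    intro k ν hs h
    rcases Nat.eq_zero_or_pos ν.card with h0 | hpos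
    · rw [sytCard_ycons_zero h0, sytCard_zero h0, h0]; simp
    · obtain ⟨m, hm⟩ : ∃ m, ν.card = m + 1 := ⟨ν.card - 1, by omega⟩
      have hk : k ≠ 0 := by
        rintro rfl
        have := card_zero_of_rowLen (Nat.le_zero.1 h)
        omega
      obtain ⟨l, rfl⟩ : ∃ l, k = l + 1 := ⟨k - 1, by omega⟩
      rw [sum_ydown_ycons h hk]
      have h1 : l.choose (m + 1) * sytCard ν ≤
          (if ν.rowLen 0 < l + 1 then sytCard (ycons (l + 1 - 1) ν) else 0) := by
        split_ifs with hlt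
        · have := ih l ν (by omega) (by omega)
          rw [hm] at this
          exact this
        · have := rowLen_zero_le_card ν
          rw [Nat.choose_eq_zero_of_lt (by omega)]; simp
      have h2 : l.choose m * sytCard ν ≤ ∑ ρ ∈ ydown ν, sytCard (ycons (l + 1) ρ) := by
        rw [sytCard_rec ν (by omega), mul_sum]
        apply sum_le_sum
        intro ρ hρ
        rw [mem_ydown] at hρ
        have hr := rowLen_mono hρ.1 0
        have := ih (l+1) ρ (by omega) (by omega)
        have hc : ρ.card = m := by omega
        rw [hc] at this
        exact (Nat.mul_le_mul_right _ (Nat.choose_le_choose m (Nat.le_succ l))).trans this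
      rw [hm, Nat.choose_succ_succ, add_mul]
      simp only [Nat.succ_eq_add_one] at *
      omega

lemma prob_eq (n k : ℕ) : plancherelRowProb n k =
    ((∑ μ ∈ (yds n).filter (fun μ => μ.rowLen 0 = k), sytCard μ ^ 2 : ℕ) : ℝ) / n.factorial := by
  have hs : {μ : YoungDiagram | μ.card = n ∧ μ.rowLen 0 = k} =
      (((yds n).filter (fun μ => μ.rowLen 0 = k) : Finset YoungDiagram) : Set YoungDiagram) := by
    ext μ; simp [mem_yds]
  unfold plancherelRowProb
  have h1 := Finset.tsum_subtype' ((yds n).filter (fun μ => μ.rowLen 0 = k))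
    (fun μ => (sytCard μ : ℝ) ^ 2 / (Nat.factorial n : ℝ))
  rw [← hs] at h1
  refine h1.trans ?_
  rw [← sum_div]
  push_cast
  rfl

lemma rowSum_eq (k m : ℕ) :
    ∑ μ ∈ (yds (k + m)).filter (fun μ => μ.rowLen 0 = k), sytCard μ ^ 2 =
    ∑ ν ∈ (yds m).filter (fun ν => ν.rowLen 0 ≤ k), sytCard (ycons k ν) ^ 2 := by
  symm
  refine sum_bij' (fun ν _ => ycons k ν) (fun μ _ => ytail μ) ?_ ?_ ?_ ?_ ?_
  · intro ν h
    simp only [mem_filter, mem_yds] at h ⊢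
    exact ⟨by rw [card_ycons h.2]; omega, rowLen_ycons _ _⟩
  · intro μ h
    simp only [mem_filter, mem_yds] at h ⊢
    have := card_ytail μ
    refine ⟨by omega, ?_⟩
    rw [← h.2]
    by_contra hcon
    push Not at hcon
    have := lt_rowLen_zero (mem_ytail.1 (YoungDiagram.mem_iff_lt_rowLen.2 hcon))
    omega
  · intro ν h
    simp only [mem_filter, mem_yds] at h
    exact ytail_ycons h.2
  · intro μ h
    simp only [mem_filter, mem_yds] at h
    rw [← h.2, ycons_ytail]
  · intro ν h
    rfl

lemma prob_upper (k m : ℕ) : plancherelRowProb (k + m) k ≤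
    ((k + m).choose m : ℝ) ^ 2 * m.factorial / (k + m).factorial := by
  rw [prob_eq, rowSum_eq]
  apply div_le_div_of_nonneg_right _ (by positivity)
  have : ∑ ν ∈ (yds m).filter (fun ν => ν.rowLen 0 ≤ k), sytCard (ycons k ν) ^ 2 ≤
      (k + m).choose m ^ 2 * m.factorial := by
    rw [← sum_sq sytCard sytCard_rec sytCard_bot m, mul_sum]
    refine le_trans ?_ (sum_le_sum_of_subset (filter_subset (fun ν => ν.rowLen 0 ≤ k) (yds m)))
    apply sum_le_sum
    intro ν h
    simp only [mem_filter, mem_yds] at h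
    have := syt_upper _ k ν rfl h.2
    rw [h.1] at this
    rw [← mul_pow]
    exact Nat.pow_le_pow_left this 2
  exact_mod_cast this

lemma prob_lower (k m : ℕ) (hmk : m ≤ k) :
    (k.choose m : ℝ) ^ 2 * m.factorial / (k + m).factorial ≤ plancherelRowProb (k + m) k := by
  rw [prob_eq, rowSum_eq]
  apply div_le_div_of_nonneg_right _ (by positivity)
  have hf : (yds m).filter (fun ν => ν.rowLen 0 ≤ k) = yds m := by
    apply filter_true_of_mem
    intro ν h
    have := rowLen_zero_le_card ν
    rw [mem_yds] at h
    omega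
  have : k.choose m ^ 2 * m.factorial ≤
      ∑ ν ∈ (yds m).filter (fun ν => ν.rowLen 0 ≤ k), sytCard (ycons k ν) ^ 2 := by
    rw [← sum_sq sytCard sytCard_rec sytCard_bot m, mul_sum, hf]
    apply sum_le_sum
    intro ν h
    rw [← hf] at h
    simp only [mem_filter, mem_yds] at h
    have := syt_lower _ k ν rfl h.2
    rw [h.1] at this
    rw [← mul_pow]
    exact Nat.pow_le_pow_left this 2
  exact_mod_cast this

lemma prob_nonneg (n k : ℕ) : 0 ≤ plancherelRowProb n k := by
  rw [prob_eq]; positivity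

lemma prob_zero (n k : ℕ) (h : n < k) : plancherelRowProb n k = 0 := by
  rw [prob_eq, filter_false_of_mem]
  · simp
  · intro μ hμ
    have := rowLen_zero_le_card μ
    rw [mem_yds] at hμ
    omega

/-- the analytic inequality, with `m = p + 1` -/
lemma final_ineq (n p : ℕ) (hn : 8 * (p + 1) ^ 2 * (p + 2) ≤ n) :
    ((n.choose (p + 2) : ℝ) ^ 2 * (p + 2).factorial) * ((n.choose p : ℝ) ^ 2 * p.factorial) ≤
    (((n - (p + 1)).choose (p + 1) : ℝ) ^ 2 * (p + 1).factorial) ^ 2 := by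
  have hn2 : 2 * (p + 1) ≤ n := by nlinarith [sq_nonneg (p : ℤ)]
  have hnpos : (0 : ℝ) < n := by exact_mod_cast (by omega : 0 < n)
  have h1 : (n.choose (p + 2) : ℝ) ≤ (n : ℝ) ^ (p + 2) / (p + 2).factorial :=
    Nat.choose_le_pow_div _ _
  have h2 : (n.choose p : ℝ) ≤ (n : ℝ) ^ p / p.factorial := Nat.choose_le_pow_div _ _
  have h3 : ((n : ℝ) - 2 * (p + 1)) ^ (p + 1) / (p + 1).factorial ≤
      ((n - (p + 1)).choose (p + 1) : ℝ) := by
    refine le_trans ?_ (Nat.pow_le_choose (p + 1) (n - (p + 1)))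
    apply div_le_div_of_nonneg_right _ (by positivity)
    have : ((n - (p+1) + 1 - (p + 1) : ℕ) : ℝ) = (n : ℝ) - 2 * (p + 1) + 1 := by
      rw [show n - (p+1) + 1 - (p+1) = n - 2 * (p+1) + 1 by omega]
      push_cast [Nat.cast_sub hn2]
      ring
    rw [this]
    apply pow_le_pow_left₀
    · have : ((2 * (p + 1) : ℕ) : ℝ) ≤ n := by exact_mod_cast hn2
      push_cast at this
      linarith
    · linarith
  have hx0 : 0 ≤ (n : ℝ) - 2 * (p + 1) := by
    have : ((2 * (p + 1) : ℕ) : ℝ) ≤ n := by exact_mod_cast hn2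
    push_cast at this
    linarith
  have hf0 : (0 : ℝ) < p.factorial := by positivity
  have e1 : ((p + 1).factorial : ℝ) = (p + 1) * p.factorial := by
    rw [Nat.factorial_succ]; push_cast; ring
  have e2 : ((p + 2).factorial : ℝ) = (p + 2) * ((p + 1) * p.factorial) := by
    rw [Nat.factorial_succ, Nat.cast_mul, e1]; push_cast; ring
  have hb : ((p : ℝ) + 1) / (p + 2) * n ^ (4 * (p + 1)) ≤
      ((n : ℝ) - 2 * (p + 1)) ^ (4 * (p + 1)) := by
    have hx : (n : ℝ) - 2 * (p + 1) = (1 + (-(2 * (p + 1) / n))) * n := by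
      field_simp; ring
    rw [hx, mul_pow]
    apply mul_le_mul_of_nonneg_right _ (by positivity)
    have hle1 : 2 * ((p : ℝ) + 1) / n ≤ 1 := by
      rw [div_le_one hnpos]; linarith
    refine le_trans ?_ (one_add_mul_le_pow (by linarith) _)
    have hn' : 8 * ((p : ℝ) + 1) ^ 2 * (p + 2) ≤ n := by exact_mod_cast hn
    have : 8 * ((p : ℝ) + 1) ^ 2 / n ≤ 1 / (p + 2) := by
      rw [div_le_div_iff₀ hnpos (by positivity)]; linarith
    have e3 : ((p : ℝ) + 1) / (p + 2) = 1 - 1 / (p + 2) := by field_simp; ring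
    rw [e3]
    push_cast
    have e4 : 4 * ((p : ℝ) + 1) * -(2 * (p + 1) / n) = - (8 * ((p : ℝ) + 1) ^ 2 / n) := by ring
    rw [e4]
    linarith
  calc ((n.choose (p + 2) : ℝ) ^ 2 * (p + 2).factorial) * ((n.choose p : ℝ) ^ 2 * p.factorial)
      ≤ (((n : ℝ) ^ (p + 2) / (p + 2).factorial) ^ 2 * (p + 2).factorial) *
        (((n : ℝ) ^ p / p.factorial) ^ 2 * p.factorial) := by gcongr
    _ = (((p : ℝ) + 1) / (p + 2) * n ^ (4 * (p + 1))) / ((p + 1) * p.factorial) ^ 2 := by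
        rw [e2]; field_simp; ring
    _ ≤ ((n : ℝ) - 2 * (p + 1)) ^ (4 * (p + 1)) / ((p + 1) * p.factorial) ^ 2 := by gcongr
    _ = ((((n : ℝ) - 2 * (p + 1)) ^ (p + 1) / (p + 1).factorial) ^ 2 * (p + 1).factorial) ^ 2 := by
        rw [e1]; field_simp; ring
    _ ≤ _ := by gcongr

theorem chen_conjecture_partial (j : ℕ) :
    ∃ N : ℕ, ∀ n : ℕ, N ≤ n → ∀ k : ℕ, n - j ≤ k → k ≤ n →
      plancherelRowProb n (k - 1) * plancherelRowProb n (k + 1) ≤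
        (plancherelRowProb n k) ^ 2 := by
  refine ⟨8 * (j + 1) ^ 2 * (j + 2), ?_⟩
  intro n hn k hk1 hk2
  rcases eq_or_lt_of_le hk2 with rfl | hlt
  · rw [prob_zero k (k+1) (by omega), mul_zero]
    positivity
  · obtain ⟨p, hp⟩ : ∃ p, n = k + (p + 1) := ⟨n - k - 1, by omega⟩
    have hpj : p + 1 ≤ j := by omega
    have hn2 : 8 * (p + 1) ^ 2 * (p + 2) ≤ n := by
      refine le_trans ?_ hn
      gcongr <;> omega
    have hbig : 2 * (j + 1) ≤ n := by nlinarith [sq_nonneg (j : ℤ)]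
    have u1 := prob_upper (k - 1) (p + 2)
    have u2 := prob_upper (k + 1) p
    have u3 := prob_lower k (p + 1) (by omega)
    rw [show k - 1 + (p + 2) = n by omega] at u1
    rw [show k + 1 + p = n by omega] at u2
    rw [← hp] at u3
    have hf := final_ineq n p hn2
    rw [show n - (p + 1) = k by omega] at hf
    have hF : (0 : ℝ) < n.factorial := by positivity
    calc _ ≤ ((n.choose (p + 2) : ℝ) ^ 2 * (p + 2).factorial / n.factorial) *
          ((n.choose p : ℝ) ^ 2 * p.factorial / n.factorial) :=
          mul_le_mul u1 u2 (prob_nonneg _ _) (by positivity)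
      _ = ((n.choose (p + 2) : ℝ) ^ 2 * (p + 2).factorial) *
          ((n.choose p : ℝ) ^ 2 * p.factorial) / (n.factorial : ℝ) ^ 2 := by
          field_simp
      _ ≤ ((k.choose (p + 1) : ℝ) ^ 2 * (p + 1).factorial) ^ 2 / (n.factorial : ℝ) ^ 2 := by
          gcongr
      _ = ((k.choose (p + 1) : ℝ) ^ 2 * (p + 1).factorial / n.factorial) ^ 2 := by
          rw [div_pow]
      _ ≤ _ := by gcongr
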